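/- arXiv:2205.15856 — 2 statements merged into one kernel-verified Lean document; each statement's English description precedes it below -/
import Mathlib

section
/- Let C, Ĉ ∈ ℝ^{m×m}, set E := Ĉ − C, and let h_0,…,h_K be real coefficients. Define the remainder D̃ := Σ_{k=0}^K h_k Ĉ^k − Σ_{k=0}^K h_k C^k − Σ_{k=0}^K h_k Σ_{r=0}^{k−1} C^r E C^{k−1−r}. Then, in the operator norm induced by the Euclidean vector norm, ‖D̃‖ ≤ Σ_{k=0}^K |h_k| Σ_{r=2}^{k} (k choose r) ‖E‖^r ‖C‖^{k−r}. -/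
open Matrix
open scoped BigOperators

/-- The operator norm on `ℝ^{m×m}` induced by the Euclidean norm on `ℝ^m`. -/
noncomputable def euclOpNorm {m : ℕ} (A : Matrix (Fin m) (Fin m) ℝ) : ℝ :=
  ‖Matrix.toEuclideanCLM (𝕜 := ℝ) A‖

section NormedRing

variable {R : Type*} [NormedRing R]

lemma norm_pow_le_of_norm_one_le (h1 : ‖(1 : R)‖ ≤ 1) (x : R) (k : ℕ) : ‖x ^ k‖ ≤ ‖x‖ ^ k := by
  rcases Nat.eq_zero_or_pos k with rfl | hk
  · simpa using h1
  · exact norm_pow_le' x hk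

lemma norm_add_pow_sub_pow_le (h1 : ‖(1 : R)‖ ≤ 1) (c e : R) (k : ℕ) :
    ‖(c + e) ^ k - c ^ k‖ ≤ (‖e‖ + ‖c‖) ^ k - ‖c‖ ^ k := by
  induction k with
  | zero => simp
  | succ k ih =>
    have hpow : ‖(c + e) ^ k‖ ≤ (‖e‖ + ‖c‖) ^ k :=
      (norm_pow_le_of_norm_one_le h1 _ k).trans
        (pow_le_pow_left₀ (norm_nonneg _) ((norm_add_le c e).trans_eq (add_comm _ _)) k)
    calc ‖(c + e) ^ (k + 1) - c ^ (k + 1)‖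
        = ‖((c + e) ^ k - c ^ k) * c + (c + e) ^ k * e‖ := by
          congr 1; rw [pow_succ, pow_succ]; noncomm_ring
      _ ≤ ‖(c + e) ^ k - c ^ k‖ * ‖c‖ + ‖(c + e) ^ k‖ * ‖e‖ :=
          (norm_add_le _ _).trans (add_le_add (norm_mul_le _ _) (norm_mul_le _ _))
      _ ≤ ((‖e‖ + ‖c‖) ^ k - ‖c‖ ^ k) * ‖c‖ + (‖e‖ + ‖c‖) ^ k * ‖e‖ := by gcongr
      _ = (‖e‖ + ‖c‖) ^ (k + 1) - ‖c‖ ^ (k + 1) := by ring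

/-- The first-order variation of `c ^ k` in the direction `e`, expanded one degree further. -/
lemma sum_pow_mul_mul_pow_succ {S : Type*} [Semiring S] (c e : S) (k : ℕ) :
    ∑ r ∈ Finset.range (k + 1), c ^ r * e * c ^ (k + 1 - 1 - r) =
      (∑ r ∈ Finset.range k, c ^ r * e * c ^ (k - 1 - r)) * c + c ^ k * e := by
  rw [Finset.sum_range_succ, Finset.sum_mul]
  congr 1
  · refine Finset.sum_congr rfl fun r hr => ?_
    have hr' : k + 1 - 1 - r = (k - 1 - r) + 1 := by
      have := Finset.mem_range.mp hr
      omega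
    rw [hr', pow_succ, ← mul_assoc]
  · simp

lemma norm_add_pow_sub_first_order_le (h1 : ‖(1 : R)‖ ≤ 1) (c e : R) (k : ℕ) :
    ‖(c + e) ^ k - c ^ k - ∑ r ∈ Finset.range k, c ^ r * e * c ^ (k - 1 - r)‖ ≤
      (‖e‖ + ‖c‖) ^ k - ‖c‖ ^ k - k * ‖e‖ * ‖c‖ ^ (k - 1) := by
  induction k with
  | zero => simp
  | succ k ih =>
    rw [sum_pow_mul_mul_pow_succ]
    set L := ∑ r ∈ Finset.range k, c ^ r * e * c ^ (k - 1 - r)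
    calc ‖(c + e) ^ (k + 1) - c ^ (k + 1) - (L * c + c ^ k * e)‖
        = ‖((c + e) ^ k - c ^ k - L) * c + ((c + e) ^ k - c ^ k) * e‖ := by
          congr 1; rw [pow_succ, pow_succ]; noncomm_ring
      _ ≤ ‖(c + e) ^ k - c ^ k - L‖ * ‖c‖ + ‖(c + e) ^ k - c ^ k‖ * ‖e‖ :=
          (norm_add_le _ _).trans (add_le_add (norm_mul_le _ _) (norm_mul_le _ _))
      _ ≤ ((‖e‖ + ‖c‖) ^ k - ‖c‖ ^ k - k * ‖e‖ * ‖c‖ ^ (k - 1)) * ‖c‖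
            + ((‖e‖ + ‖c‖) ^ k - ‖c‖ ^ k) * ‖e‖ := by
          gcongr
          exact norm_add_pow_sub_pow_le h1 c e k
      _ = (‖e‖ + ‖c‖) ^ (k + 1) - ‖c‖ ^ (k + 1)
            - (k + 1 : ℕ) * ‖e‖ * ‖c‖ ^ (k + 1 - 1) := by
          cases k with
          | zero => simp
          | succ n => simp only [Nat.add_sub_cancel]; push_cast; ring

end NormedRing

lemma sum_Icc_two_choose_mul_pow (a b : ℝ) (k : ℕ) :
    ∑ r ∈ Finset.Icc 2 k, (k.choose r : ℝ) * a ^ r * b ^ (k - r) =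
      (a + b) ^ k - b ^ k - k * a * b ^ (k - 1) := by
  rcases k with _ | _ | n
  · simp
  · simp
  · rw [add_pow, Finset.sum_range_succ', Finset.sum_range_succ', ← Finset.Ico_add_one_right_eq_Icc,
      Finset.sum_Ico_eq_sum_range]
    have hsum : ∑ i ∈ Finset.range (n + 1 + 1 + 1 - 2),
          ((n + 1 + 1).choose (2 + i) : ℝ) * a ^ (2 + i) * b ^ (n + 1 + 1 - (2 + i)) =
        ∑ i ∈ Finset.range (n + 1), a ^ (i + 1 + 1) * b ^ (n + 1 + 1 - (i + 1 + 1)) *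
          ((n + 1 + 1).choose (i + 1 + 1) : ℝ) := by
      refine Finset.sum_congr rfl fun i _ => ?_
      rw [show 2 + i = i + 1 + 1 by omega]
      ring
    rw [hsum]
    simp
    ring

/-- **First-order expansion remainder for coVariance filters.**
With `E := Ĉ − C` and
`D̃ := ∑ₖ h k • Ĉ^k − ∑ₖ h k • C^k − ∑ₖ h k • ∑_{r<k} C^r E C^{k−1−r}`, one has
`‖D̃‖ ≤ ∑ₖ |h k| ∑_{r=2}^{k} (k choose r) ‖E‖^r ‖C‖^{k−r}`. -/
theorem filter_expansion_remainder_bound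
    (m K : ℕ) (C Chat : Matrix (Fin m) (Fin m) ℝ) (h : ℕ → ℝ) :
    euclOpNorm
        ((∑ k ∈ Finset.range (K + 1), h k • Chat ^ k)
          - (∑ k ∈ Finset.range (K + 1), h k • C ^ k)
          - ∑ k ∈ Finset.range (K + 1),
              h k • ∑ r ∈ Finset.range k, C ^ r * (Chat - C) * C ^ (k - 1 - r))
      ≤ ∑ k ∈ Finset.range (K + 1), |h k| *
          ∑ r ∈ Finset.Icc 2 k,
            (k.choose r : ℝ) * euclOpNorm (Chat - C) ^ r * euclOpNorm C ^ (k - r) := by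
  have h1 : ‖(1 : EuclideanSpace ℝ (Fin m) →L[ℝ] EuclideanSpace ℝ (Fin m))‖ ≤ 1 :=
    ContinuousLinearMap.norm_id_le
  rw [← Finset.sum_sub_distrib, ← Finset.sum_sub_distrib]
  unfold euclOpNorm
  rw [map_sum]
  refine norm_sum_le_of_le _ fun k _ => ?_
  rw [← smul_sub, ← smul_sub, map_smul, norm_smul, Real.norm_eq_abs, sum_Icc_two_choose_mul_pow]
  refine mul_le_mul_of_nonneg_left ?_ (abs_nonneg _)
  have key := norm_add_pow_sub_first_order_le h1 (Matrix.toEuclideanCLM (𝕜 := ℝ) C)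
    (Matrix.toEuclideanCLM (𝕜 := ℝ) (Chat - C)) k
  rw [← map_add, add_sub_cancel] at key
  simpa only [map_sub, map_sum, map_mul, map_pow] using key
end

section
/- Let C ∈ ℝ^{m×m} be symmetric with an orthonormal eigenbasis v_1,…,v_m of ℝ^m and corresponding real eigenvalues λ_1,…,λ_m, let h_0,…,h_K be real coefficients with frequency response h(λ) = Σ_{k=0}^K h_k λ^k, fix i ∈ {1,…,m}, and let u_i ∈ ℝ^m be arbitrary. Then Σ_{k=0}^K h_k Σ_{r=0}^{k−1} λ_i^{k−1−r} C^r (λ_i I_m − C)(u_i − v_i) = Σ_{j≠i} (h(λ_i) − h(λ_j)) (v_jᵀ u_i) v_j. -/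
open Matrix
open scoped BigOperators

/-- A family orthonormal for the dot product gives the expansion `u = ∑ⱼ (vⱼᵀ u) vⱼ`. -/
theorem sum_dotProduct_smul_of_orthonormal {n R : Type*} [Fintype n] [DecidableEq n] [CommRing R]
    {v : n → n → R} (horth : ∀ i j, v i ⬝ᵥ v j = if i = j then 1 else 0) (u : n → R) :
    ∑ j, (v j ⬝ᵥ u) • v j = u := by
  have hP : Matrix.of v * (Matrix.of v)ᵀ = 1 := by
    ext a b
    rw [Matrix.one_apply, ← horth a b]
    rfl
  have hu : (Matrix.of v)ᵀ *ᵥ (Matrix.of v *ᵥ u) = u := by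
    rw [Matrix.mulVec_mulVec, mul_eq_one_comm.mp hP, Matrix.one_mulVec]
  conv_rhs => rw [← hu]
  rw [Matrix.mulVec_transpose, Matrix.vecMul_eq_sum]
  rfl

theorem pow_mulVec_of_mulVec_eq_smul {n R : Type*} [Fintype n] [DecidableEq n] [CommRing R]
    {A : Matrix n n R} {x : n → R} {μ : R} (hx : A *ᵥ x = μ • x) (k : ℕ) :
    (A ^ k) *ᵥ x = μ ^ k • x := by
  induction k with
  | zero => simp
  | succ k ih => rw [pow_succ, ← Matrix.mulVec_mulVec, hx, Matrix.mulVec_smul, ih, smul_smul,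
      pow_succ']

theorem sum_smul_pow_mul_smul_one_sub {R A : Type*} [CommRing R] [Ring A] [Algebra R A]
    (a : A) (μ : R) (k : ℕ) :
    ∑ r ∈ Finset.range k, μ ^ (k - 1 - r) • (a ^ r * (μ • 1 - a)) = μ ^ k • 1 - a ^ k := by
  have hcomm : Commute a (μ • 1 : A) := (Commute.one_right a).smul_right μ
  have hgeom := hcomm.geom_sum₂_mul k
  simp only [smul_pow, one_pow, mul_smul_comm, mul_one] at hgeom
  rw [← neg_sub (a ^ k), ← hgeom, ← mul_neg, neg_sub, Finset.sum_mul]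
  simp_rw [smul_mul_assoc]

/-- **Closed form of Term 1 in the stability analysis.**
For a symmetric `C` with orthonormal eigenbasis `v` and eigenvalues `λ`, coefficients
`h 0, …, h K` with frequency response `h(λ) = ∑ₖ h k λ^k`, any index `i`, and any
vector `uᵢ`,
`∑ₖ h k ∑_{r<k} λᵢ^{k−1−r} C^r (λᵢ I − C)(uᵢ − vᵢ)
  = ∑_{j≠i} (h(λᵢ) − h(λⱼ)) (vⱼᵀ uᵢ) vⱼ`. -/
theorem term1_closed_form
    (m K : ℕ) (C : Matrix (Fin m) (Fin m) ℝ) (hsymm : C.IsSymm)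
    (v : Fin m → (Fin m → ℝ)) (lam : Fin m → ℝ)
    (horth : ∀ i j, v i ⬝ᵥ v j = if i = j then (1 : ℝ) else 0)
    (heig : ∀ j, C.mulVec (v j) = lam j • v j)
    (h : ℕ → ℝ) (i : Fin m) (u : Fin m → ℝ) :
    (∑ k ∈ Finset.range (K + 1),
        h k • ∑ r ∈ Finset.range k,
          lam i ^ (k - 1 - r) •
            ((C ^ r * (lam i • (1 : Matrix (Fin m) (Fin m) ℝ) - C)).mulVec (u - v i)))
      = ∑ j ∈ Finset.univ.erase i,
          (((∑ k ∈ Finset.range (K + 1), h k * lam i ^ k)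
              - ∑ k ∈ Finset.range (K + 1), h k * lam j ^ k) * (v j ⬝ᵥ u)) • v j := by
  have hdiff (k : ℕ) (j : Fin m) :
      (lam i ^ k • (1 : Matrix (Fin m) (Fin m) ℝ) - C ^ k) *ᵥ v j
        = (lam i ^ k - lam j ^ k) • v j := by
    rw [Matrix.sub_mulVec, Matrix.smul_mulVec, Matrix.one_mulVec,
      pow_mulVec_of_mulVec_eq_smul (heig j), sub_smul]
  have hinner (k : ℕ) :
      ∑ r ∈ Finset.range k, lam i ^ (k - 1 - r) •
          ((C ^ r * (lam i • (1 : Matrix (Fin m) (Fin m) ℝ) - C)).mulVec (u - v i))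
        = ∑ j, ((lam i ^ k - lam j ^ k) * (v j ⬝ᵥ u)) • v j := by
    simp_rw [← Matrix.smul_mulVec]
    rw [← Matrix.sum_mulVec, sum_smul_pow_mul_smul_one_sub, Matrix.mulVec_sub, hdiff k i, sub_self,
      zero_smul, sub_zero]
    conv_lhs => rw [← sum_dotProduct_smul_of_orthonormal horth u]
    rw [Matrix.mulVec_sum]
    refine Finset.sum_congr rfl fun j _ => ?_
    rw [Matrix.mulVec_smul, hdiff, smul_smul, mul_comm]
  simp_rw [hinner, Finset.smul_sum]
  rw [Finset.sum_comm, ← Finset.add_sum_erase _ _ (Finset.mem_univ i)]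
  simp only [sub_self, zero_mul, zero_smul, smul_zero, Finset.sum_const_zero, zero_add]
  refine Finset.sum_congr rfl fun j _ => ?_
  simp_rw [smul_smul]
  rw [← Finset.sum_smul, ← Finset.sum_sub_distrib, Finset.sum_mul]
  congr 1
  exact Finset.sum_congr rfl fun k _ => by ring
end
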